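/- arXiv:1812.03714 — 2 statements merged into one kernel-verified Lean document; each statement's English description precedes it below -/
import Mathlib

section
/- Let w ∈ G(e,e,n) and for each row i let a_i = w[i, c_i] be the unique nonzero entry on row i. For 3 ≤ i ≤ n: if c_{i−1} < c_i, then ℓ(s_i w) = ℓ(w) − 1 if and only if a_i ≠ 1; and if c_{i−1} > c_i, then ℓ(s_i w) = ℓ(w) − 1 if and only if a_{i−1} = 1. Here ℓ denotes word length over the generating set {t_0,...,t_{e−1}, s_3,...,s_n}. -/
noncomputable section

open Matrix

/-- The primitive `e`-th root of unity `ζ_e = exp(2πi/e)`. -/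
def zeta (e : ℕ) : ℂ := Complex.exp (2 * (Real.pi : ℂ) * Complex.I / (e : ℂ))

/-- The generator `t_i` of `G(e,e,n)`: it swaps the first two coordinates with
multipliers `ζ_e^{-i}` and `ζ_e^{i}` and is the identity elsewhere. -/
def tmat (e n i : ℕ) : Matrix (Fin n) (Fin n) ℂ :=
  Matrix.of fun p q =>
    if (p : ℕ) = 0 ∧ (q : ℕ) = 1 then (zeta e)⁻¹ ^ i
    else if (p : ℕ) = 1 ∧ (q : ℕ) = 0 then zeta e ^ i
    else if (p : ℕ) = (q : ℕ) ∧ 2 ≤ (p : ℕ) then 1 else 0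

/-- The generator `s_j` of `G(e,e,n)` (`3 ≤ j ≤ n`, 1-based): the permutation
matrix of the transposition `(j-1, j)`. -/
def smat (n j : ℕ) : Matrix (Fin n) (Fin n) ℂ :=
  Matrix.of fun p q =>
    if (p : ℕ) = j - 2 ∧ (q : ℕ) = j - 1 then 1
    else if (p : ℕ) = j - 1 ∧ (q : ℕ) = j - 2 then 1
    else if (p : ℕ) = (q : ℕ) ∧ (p : ℕ) ≠ j - 2 ∧ (p : ℕ) ≠ j - 1 then 1 else 0

/-- The Corran–Picantin generating set `X = {t_0,…,t_{e-1}, s_3,…,s_n}`. -/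
def genSet (e n : ℕ) : Set (Matrix (Fin n) (Fin n) ℂ) :=
  {M | (∃ i < e, M = tmat e n i) ∨ ∃ j, 3 ≤ j ∧ j ≤ n ∧ M = smat n j}

/-- Membership in `G(e,e,n)`: a monomial matrix whose nonzero entries are
`e`-th roots of unity with product of nonzero entries equal to `1`.
(Each row sum is the unique nonzero entry of that row.) -/
def IsGeen (e n : ℕ) (w : Matrix (Fin n) (Fin n) ℂ) : Prop :=
  (∀ i, ∃! j, w i j ≠ 0) ∧ (∀ j, ∃! i, w i j ≠ 0) ∧
  (∀ i j, w i j ≠ 0 → w i j ^ e = 1) ∧ (∏ i, ∑ j, w i j) = 1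

/-- Word length over the Corran–Picantin generating set. -/
def len (e n : ℕ) (w : Matrix (Fin n) (Fin n) ℂ) : ℕ :=
  sInf {l | ∃ L : List (Matrix (Fin n) (Fin n) ℂ),
    (∀ x ∈ L, x ∈ genSet e n) ∧ L.prod = w ∧ L.length = l}

/-- The element `λ`: diagonal with `λ[i,i] = ζ_e` for `i ≥ 2` (1-based) and
`λ[1,1] = ζ_e^{-(n-1)}`. -/
def lamMat (e n : ℕ) : Matrix (Fin n) (Fin n) ℂ :=
  Matrix.of fun p q =>
    if p = q then (if (p : ℕ) = 0 then (zeta e)⁻¹ ^ (n - 1) else zeta e) else 0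

/-- Left divisibility: `u ⪯ w` iff `w = u v` with `ℓ(u) + ℓ(v) = ℓ(w)`. -/
def LDiv (e n : ℕ) (u w : Matrix (Fin n) (Fin n) ℂ) : Prop :=
  ∃ v, IsGeen e n v ∧ u * v = w ∧ len e n u + len e n v = len e n w

/-- Right divisibility: `u ⪯_r w` iff `w = v u` with `ℓ(v) + ℓ(u) = ℓ(w)`. -/
def RDiv (e n : ℕ) (u w : Matrix (Fin n) (Fin n) ℂ) : Prop :=
  ∃ v, IsGeen e n v ∧ v * u = w ∧ len e n v + len e n u = len e n w

/-- The monomial matrix whose nonzero entry on row `p` is `a p`, in column `c p`. -/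
def monoMat {n : ℕ} (c : Equiv.Perm (Fin n)) (a : Fin n → ℂ) : Matrix (Fin n) (Fin n) ℂ :=
  Matrix.of fun p q => if q = c p then a p else 0

/-- The contribution of a pair of rows to the length of a monomial matrix. -/
def pairWeight {n : ℕ} (c : Equiv.Perm (Fin n)) (a : Fin n → ℂ) (p : Fin n × Fin n) : ℕ :=
  if c p.2 < c p.1 then 1 else if a p.2 = 1 then 0 else 2

/-- The combinatorial formula for the length: the sum of the contributions of all pairs of rows. -/
def weight {n : ℕ} (c : Equiv.Perm (Fin n)) (a : Fin n → ℂ) : ℕ :=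
  ∑ p : Fin n × Fin n with p.1 < p.2, pairWeight c a p

/-- The data `(swap r1 r2, b)` of a monomial matrix that behaves like a generator: it exchanges
two consecutive rows and acts trivially on the weight of the other pairs. -/
structure IsGenData (e : ℕ) {n : ℕ} (r1 r2 : Fin n) (b : Fin n → ℂ) : Prop where
  succ : (r2 : ℕ) = r1 + 1
  eq_one : ∀ j i, j < i → (j, i) ≠ (r1, r2) → b i = 1
  mul_swap : ∀ p, b p * b (Equiv.swap r1 r2 p) = 1
  pow_eq_one : ∀ p, b p ^ e = 1
  prod_eq_one : ∏ p, b p = 1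

/-- The nonzero entries are `e`-th roots of unity with product `1`. -/
def IsEntries (e : ℕ) {n : ℕ} (a : Fin n → ℂ) : Prop :=
  (∀ p, a p ^ e = 1) ∧ ∏ p, a p = 1

theorem IsEntries.ne_zero {e n : ℕ} (he : 1 ≤ e) {a : Fin n → ℂ} (ha : IsEntries e a)
    (p : Fin n) : a p ≠ 0 := by
  intro h
  have := ha.1 p
  rw [h, zero_pow (by omega)] at this
  exact zero_ne_one this

theorem monoMat_mul {n : ℕ} (σ c : Equiv.Perm (Fin n)) (b a : Fin n → ℂ) :
    monoMat σ b * monoMat c a = monoMat (c * σ) (fun p => b p * a (σ p)) := by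
  ext p r
  rw [Matrix.mul_apply, Finset.sum_eq_single (σ p)]
  · simp only [monoMat, Matrix.of_apply, if_true, mul_ite, mul_zero]
    rfl
  · intro q _ hq
    simp [monoMat, hq]
  · simp

theorem monoMat_one {n : ℕ} : monoMat (1 : Equiv.Perm (Fin n)) (fun _ => 1) = 1 := by
  ext p q
  simp [monoMat, Matrix.one_apply, eq_comm]

theorem monoMat_injective {n : ℕ} {c c' : Equiv.Perm (Fin n)} {a a' : Fin n → ℂ}
    (ha : ∀ p, a p ≠ 0) (h : monoMat c a = monoMat c' a') : c = c' ∧ a = a' := by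
  have key : ∀ p, c p = c' p ∧ a p = a' p := by
    intro p
    have h1 := congrFun (congrFun h p) (c p)
    simp only [monoMat, Matrix.of_apply, if_true] at h1
    split_ifs at h1 with h2
    · exact ⟨h2, h1⟩
    · exact absurd h1 (ha p)
  exact ⟨Equiv.ext fun p => (key p).1, funext fun p => (key p).2⟩

theorem swap_lt_swap {n : ℕ} {r1 r2 : Fin n} (hr : (r2 : ℕ) = r1 + 1) {j i : Fin n}
    (hji : j < i) (hne : (j, i) ≠ (r1, r2)) :
    Equiv.swap r1 r2 j < Equiv.swap r1 r2 i ∧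
      (Equiv.swap r1 r2 j, Equiv.swap r1 r2 i) ≠ (r1, r2) := by
  simp only [Equiv.swap_apply_def, ne_eq, Prod.mk.injEq, Fin.ext_iff, Fin.lt_def] at *
  split_ifs <;> omega

/-- Exchanging two consecutive rows changes the weight only through the pair of these rows. -/
theorem weight_genData {e n : ℕ} {r1 r2 : Fin n} {b : Fin n → ℂ} (hb : IsGenData e r1 r2 b)
    (c : Equiv.Perm (Fin n)) (a : Fin n → ℂ) :
    weight (c * Equiv.swap r1 r2) (fun p => b p * a (Equiv.swap r1 r2 p)) +
        pairWeight c a (r1, r2) =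
      weight c a + pairWeight (c * Equiv.swap r1 r2)
        (fun p => b p * a (Equiv.swap r1 r2 p)) (r1, r2) := by
  have hmem : (r1, r2) ∈ (Finset.univ.filter fun p : Fin n × Fin n => p.1 < p.2) := by
    have := hb.succ
    simp only [Finset.mem_filter, Finset.mem_univ, true_and, Fin.lt_def]
    omega
  have hsum : ∑ p ∈ (Finset.univ.filter fun p : Fin n × Fin n => p.1 < p.2).erase (r1, r2),
        pairWeight (c * Equiv.swap r1 r2) (fun p => b p * a (Equiv.swap r1 r2 p)) p =
      ∑ p ∈ (Finset.univ.filter fun p : Fin n × Fin n => p.1 < p.2).erase (r1, r2),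
        pairWeight c a p := by
    refine Finset.sum_nbij' (Prod.map (Equiv.swap r1 r2) (Equiv.swap r1 r2))
      (Prod.map (Equiv.swap r1 r2) (Equiv.swap r1 r2)) ?_ ?_ ?_ ?_ ?_
    · rintro ⟨j, i⟩ h
      simp only [Finset.mem_erase, Finset.mem_filter, Finset.mem_univ, true_and,
        Prod.map_apply] at h ⊢
      exact (swap_lt_swap hb.succ h.2 h.1).symm
    · rintro ⟨j, i⟩ h
      simp only [Finset.mem_erase, Finset.mem_filter, Finset.mem_univ, true_and,
        Prod.map_apply] at h ⊢
      exact (swap_lt_swap hb.succ h.2 h.1).symm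
    · rintro ⟨j, i⟩ -
      simp
    · rintro ⟨j, i⟩ -
      simp
    · rintro ⟨j, i⟩ h
      simp only [Finset.mem_erase, Finset.mem_filter, Finset.mem_univ, true_and] at h
      simp [pairWeight, hb.eq_one j i h.2 h.1]
  unfold weight
  rw [← Finset.sum_erase_add _ _ hmem, ← Finset.sum_erase_add _ (pairWeight c a) hmem, hsum]
  ring

theorem weight_genData_of_lt {e n : ℕ} {r1 r2 : Fin n} {b : Fin n → ℂ}
    (hb : IsGenData e r1 r2 b) (c : Equiv.Perm (Fin n)) (a : Fin n → ℂ) (h : c r1 < c r2) :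
    weight (c * Equiv.swap r1 r2) (fun p => b p * a (Equiv.swap r1 r2 p)) +
        (if a r2 = 1 then 0 else 2) = weight c a + 1 := by
  have := weight_genData hb c a
  simpa [pairWeight, h, h.not_gt] using this

theorem weight_genData_of_gt {e n : ℕ} {r1 r2 : Fin n} {b : Fin n → ℂ}
    (hb : IsGenData e r1 r2 b) (c : Equiv.Perm (Fin n)) (a : Fin n → ℂ) (h : c r2 < c r1) :
    weight (c * Equiv.swap r1 r2) (fun p => b p * a (Equiv.swap r1 r2 p)) + 1 =
      weight c a + (if b r2 * a r1 = 1 then 0 else 2) := by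
  have := weight_genData hb c a
  simpa [pairWeight, h, h.not_gt] using this

theorem weight_genData_le {e n : ℕ} {r1 r2 : Fin n} {b : Fin n → ℂ}
    (hb : IsGenData e r1 r2 b) (c : Equiv.Perm (Fin n)) (a : Fin n → ℂ) :
    weight (c * Equiv.swap r1 r2) (fun p => b p * a (Equiv.swap r1 r2 p)) ≤ weight c a + 1 := by
  have hne : r1 ≠ r2 := by
    have := hb.succ
    intro h
    rw [h] at this
    omega
  rcases lt_or_gt_of_ne (c.injective.ne hne) with h | h
  · have := weight_genData_of_lt hb c a h
    omega
  · have := weight_genData_of_gt hb c a h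
    split_ifs at this <;> omega

theorem weight_one {n : ℕ} : weight (1 : Equiv.Perm (Fin n)) (fun _ => 1) = 0 := by
  refine Finset.sum_eq_zero ?_
  rintro ⟨j, i⟩ h
  simp only [Finset.mem_filter, Finset.mem_univ, true_and] at h
  simp [pairWeight, h.le]

theorem isEntries_genData {e n : ℕ} {r1 r2 : Fin n} {b : Fin n → ℂ}
    (hb : IsGenData e r1 r2 b) {a : Fin n → ℂ} (ha : IsEntries e a) :
    IsEntries e (fun p => b p * a (Equiv.swap r1 r2 p)) := by
  refine ⟨fun p => ?_, ?_⟩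
  · rw [mul_pow, hb.pow_eq_one, ha.1, one_mul]
  · rw [Finset.prod_mul_distrib, hb.prod_eq_one, Equiv.prod_comp, ha.2, one_mul]

theorem genData_mul_self {e n : ℕ} {r1 r2 : Fin n} {b : Fin n → ℂ}
    (hb : IsGenData e r1 r2 b) :
    monoMat (Equiv.swap r1 r2) b * monoMat (Equiv.swap r1 r2) b = 1 := by
  rw [monoMat_mul, Equiv.swap_mul_self, funext hb.mul_swap, monoMat_one]

theorem isGenData_one (e : ℕ) {n : ℕ} {r1 r2 : Fin n} (hr : (r2 : ℕ) = r1 + 1) :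
    IsGenData e r1 r2 (fun _ => 1) :=
  ⟨hr, by simp, by simp, by simp, by simp⟩

theorem smat_eq_monoMat {n j : ℕ} {r1 r2 : Fin n} (hj : 2 ≤ j) (hr1 : (r1 : ℕ) = j - 2)
    (hr2 : (r2 : ℕ) = j - 1) : smat n j = monoMat (Equiv.swap r1 r2) (fun _ => 1) := by
  ext p q
  simp only [smat, monoMat, Matrix.of_apply, Equiv.swap_apply_def, ← hr1, ← hr2,
    ← Fin.ext_iff, ne_eq]
  have hne : r1 ≠ r2 := by
    rw [ne_eq, Fin.ext_iff]
    omega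
  by_cases h1 : p = r1 <;> by_cases h2 : p = r2 <;> simp_all [eq_comm]

/-- The nonzero entries of the generator `t_k`. -/
def tEntries (e n k : ℕ) (p : Fin n) : ℂ :=
  if (p : ℕ) = 0 then (zeta e)⁻¹ ^ k else if (p : ℕ) = 1 then zeta e ^ k else 1

theorem zeta_isPrimitiveRoot {e : ℕ} (he : 1 ≤ e) : IsPrimitiveRoot (zeta e) e :=
  Complex.isPrimitiveRoot_exp e (by omega)

theorem isGenData_tEntries {e n k : ℕ} (he : 1 ≤ e) {r1 r2 : Fin n} (hr1 : (r1 : ℕ) = 0)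
    (hr2 : (r2 : ℕ) = 1) : IsGenData e r1 r2 (tEntries e n k) := by
  have hz := zeta_isPrimitiveRoot he
  have hz0 : zeta e ^ k ≠ 0 := pow_ne_zero _ (hz.ne_zero (by omega))
  have hne : r1 ≠ r2 := by
    rw [ne_eq, Fin.ext_iff]
    omega
  refine ⟨by omega, fun j i hji h => ?_, fun p => ?_, fun p => ?_, ?_⟩
  · have h0 : (i : ℕ) ≠ 0 := by
      rw [Fin.lt_def] at hji
      omega
    have h1 : (i : ℕ) ≠ 1 := by
      intro h1
      apply h
      rw [Fin.lt_def] at hji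
      simp only [Prod.mk.injEq, Fin.ext_iff]
      omega
    simp [tEntries, h0, h1]
  · by_cases h1 : p = r1
    · simp [h1, tEntries, hr1, hr2, hz0]
    by_cases h2 : p = r2
    · simp [h2, tEntries, hr1, hr2, hz0]
    rw [Equiv.swap_apply_of_ne_of_ne h1 h2]
    rw [Fin.ext_iff, hr1] at h1
    rw [Fin.ext_iff, hr2] at h2
    simp [tEntries, h1, h2]
  · unfold tEntries
    split_ifs
    · rw [pow_right_comm, inv_pow, hz.pow_eq_one, inv_one, one_pow]
    · rw [pow_right_comm, hz.pow_eq_one, one_pow]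
    · exact one_pow e
  · rw [Fintype.prod_eq_mul r1 r2 hne]
    · simp [tEntries, hr1, hr2, hz0]
    · rintro p ⟨h1, h2⟩
      rw [ne_eq, Fin.ext_iff, hr1] at h1
      rw [ne_eq, Fin.ext_iff, hr2] at h2
      simp [tEntries, h1, h2]

theorem tmat_eq_monoMat {e n k : ℕ} {r1 r2 : Fin n} (hr1 : (r1 : ℕ) = 0)
    (hr2 : (r2 : ℕ) = 1) : tmat e n k = monoMat (Equiv.swap r1 r2) (tEntries e n k) := by
  ext p q
  simp only [tmat, monoMat, tEntries, Matrix.of_apply, Equiv.swap_apply_def, Fin.ext_iff, hr1, hr2]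
  by_cases h1 : (p : ℕ) = 0
  · simp [h1, hr2]
  by_cases h2 : (p : ℕ) = 1
  · simp [h2, hr1]
  have h3 : 2 ≤ (p : ℕ) := by omega
  simp [h1, h2, h3, eq_comm]

theorem exists_genData_of_mem_genSet {e n : ℕ} (he : 1 ≤ e) (hn : 2 ≤ n)
    {x : Matrix (Fin n) (Fin n) ℂ} (hx : x ∈ genSet e n) :
    ∃ r1 r2 b, IsGenData e r1 r2 b ∧ x = monoMat (Equiv.swap r1 r2) b := by
  rcases hx with ⟨k, -, rfl⟩ | ⟨j, hj, hjn, rfl⟩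
  · exact ⟨⟨0, by omega⟩, ⟨1, by omega⟩, _, isGenData_tEntries he rfl rfl,
      tmat_eq_monoMat rfl rfl⟩
  · exact ⟨⟨j - 2, by omega⟩, ⟨j - 1, by omega⟩, _,
      isGenData_one e (by simp only; omega), smat_eq_monoMat (by omega) rfl rfl⟩

/-- A word is at least as long as the weight of the element it represents. -/
theorem weight_le_length {e n : ℕ} (he : 1 ≤ e) (hn : 2 ≤ n)
    (L : List (Matrix (Fin n) (Fin n) ℂ)) (hL : ∀ x ∈ L, x ∈ genSet e n) :
    ∃ c a, IsEntries e a ∧ monoMat c a = L.prod ∧ weight c a ≤ L.length := by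
  induction L with
  | nil =>
    exact ⟨1, fun _ => 1, ⟨by simp, by simp⟩, by simpa using monoMat_one, by simp [weight_one]⟩
  | cons x L ih =>
    obtain ⟨c, a, ha, hprod, hle⟩ := ih fun y hy => hL y (List.mem_cons_of_mem _ hy)
    obtain ⟨r1, r2, b, hb, rfl⟩ := exists_genData_of_mem_genSet he hn (hL x List.mem_cons_self)
    refine ⟨_, _, isEntries_genData hb ha, ?_, (weight_genData_le hb c a).trans ?_⟩
    · rw [List.prod_cons, ← hprod, monoMat_mul]
    · simpa using hle

theorem eq_one_of_lt_succ {e m : ℕ} {c : Equiv.Perm (Fin (m + 1))} {a : Fin (m + 1) → ℂ}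
    (ha : IsEntries e a) (h : ∀ i : Fin m, c i.castSucc < c i.succ ∧ a i.succ = 1) :
    c = 1 ∧ a = fun _ => 1 := by
  constructor
  · have hmono : StrictMono c := Fin.strictMono_iff_lt_succ.2 fun i => (h i).1
    exact Equiv.ext fun p => congrFun hmono.eq_id p
  · have h0 := ha.2
    rw [Fin.prod_univ_succ, Finset.prod_eq_one fun i _ => (h i).2, mul_one] at h0
    funext p
    exact Fin.cases h0 (fun i => (h i).2) p

/-- Every nontrivial element of the group has a left descent. -/
theorem exists_descent {e n : ℕ} (he : 1 ≤ e) (hn : 2 ≤ n) {c : Equiv.Perm (Fin n)}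
    {a : Fin n → ℂ} (ha : IsEntries e a) (hne : ¬ (c = 1 ∧ a = fun _ => 1)) :
    ∃ r1 r2 b, IsGenData e r1 r2 b ∧ monoMat (Equiv.swap r1 r2) b ∈ genSet e n ∧
      weight (c * Equiv.swap r1 r2) (fun p => b p * a (Equiv.swap r1 r2 p)) + 1 =
        weight c a := by
  have : NeZero e := ⟨by omega⟩
  obtain ⟨m, rfl⟩ : ∃ m, n = m + 1 := ⟨n - 1, by omega⟩
  by_contra hcon
  refine hne (eq_one_of_lt_succ ha ?_)
  have key : ∀ (i : ℕ) (hi : i < m), c (Fin.castSucc ⟨i, hi⟩) < c (Fin.succ ⟨i, hi⟩) ∧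
      a (Fin.succ ⟨i, hi⟩) = 1 := by
    intro i
    induction i with
    | zero =>
      intro hi
      have hmem (k : ℕ) (hk : k < e) : monoMat (Equiv.swap (Fin.castSucc ⟨0, hi⟩)
          (Fin.succ ⟨0, hi⟩)) (tEntries e (m + 1) k) ∈ genSet e (m + 1) :=
        Or.inl ⟨k, hk, (tmat_eq_monoMat rfl rfl).symm⟩
      have hdata (k : ℕ) : IsGenData e (Fin.castSucc ⟨0, hi⟩) (Fin.succ ⟨0, hi⟩)
          (tEntries e (m + 1) k) := isGenData_tEntries he rfl rfl
      rcases lt_or_gt_of_ne (c.injective.ne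
        (Fin.castSucc_lt_succ (i := (⟨0, hi⟩ : Fin m))).ne) with h | h
      · refine ⟨h, by_contra fun h1 => hcon ⟨_, _, _, hdata 0, hmem 0 (by omega), ?_⟩⟩
        have := weight_genData_of_lt (hdata 0) c a h
        rw [if_neg h1] at this
        omega
      · obtain ⟨k, hk, hka⟩ := (zeta_isPrimitiveRoot he).eq_pow_of_pow_eq_one
          (ξ := (a (Fin.castSucc ⟨0, hi⟩))⁻¹) (by rw [inv_pow, ha.1, inv_one])
        have := weight_genData_of_gt (hdata k) c a h
        rw [if_pos (by simpa [tEntries, hka] using inv_mul_cancel₀ (ha.ne_zero he _))] at this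
        exact absurd ⟨_, _, _, hdata k, hmem k hk, this⟩ hcon
    | succ i ih =>
      intro hi
      have h1 := (ih (by omega)).2
      have hmem : monoMat (Equiv.swap (Fin.castSucc ⟨i + 1, hi⟩)
          (Fin.succ ⟨i + 1, hi⟩)) (fun _ => 1) ∈ genSet e (m + 1) :=
        Or.inr ⟨i + 3, by omega, by omega, (smat_eq_monoMat (by omega) rfl rfl).symm⟩
      have hdata := isGenData_one e (r1 := Fin.castSucc ⟨i + 1, hi⟩)
        (r2 := Fin.succ ⟨i + 1, hi⟩) rfl
      rcases lt_or_gt_of_ne (c.injective.ne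
        (Fin.castSucc_lt_succ (i := (⟨i + 1, hi⟩ : Fin m))).ne) with h | h
      · refine ⟨h, by_contra fun h2 => hcon ⟨_, _, _, hdata, hmem, ?_⟩⟩
        have := weight_genData_of_lt hdata c a h
        rw [if_neg h2] at this
        omega
      · have := weight_genData_of_gt hdata c a h
        rw [if_pos (by rw [one_mul]; exact h1)] at this
        exact absurd ⟨_, _, _, hdata, hmem, this⟩ hcon
  exact fun i => key i i.2

theorem exists_word {e n : ℕ} (he : 1 ≤ e) (hn : 2 ≤ n) (N : ℕ) (c : Equiv.Perm (Fin n))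
    (a : Fin n → ℂ) (ha : IsEntries e a) (hN : weight c a = N) :
    ∃ L : List (Matrix (Fin n) (Fin n) ℂ),
      (∀ x ∈ L, x ∈ genSet e n) ∧ L.prod = monoMat c a ∧ L.length = N := by
  induction N generalizing c a with
  | zero =>
    have hone : c = 1 ∧ a = fun _ => 1 := by
      by_contra hne
      obtain ⟨r1, r2, b, -, -, h⟩ := exists_descent he hn ha hne
      omega
    exact ⟨[], by simp, by rw [hone.1, hone.2, monoMat_one, List.prod_nil], rfl⟩
  | succ N ih =>
    have hne : ¬ (c = 1 ∧ a = fun _ => 1) := by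
      rintro ⟨rfl, rfl⟩
      rw [weight_one] at hN
      omega
    obtain ⟨r1, r2, b, hb, hmem, h⟩ := exists_descent he hn ha hne
    obtain ⟨L, hL, hprod, hlen⟩ := ih _ _ (isEntries_genData hb ha)
      (Nat.add_right_cancel (h.trans hN))
    refine ⟨monoMat (Equiv.swap r1 r2) b :: L, ?_, ?_, by simp [hlen]⟩
    · simpa using ⟨hmem, hL⟩
    · rw [List.prod_cons, hprod, ← monoMat_mul, ← mul_assoc, genData_mul_self hb, one_mul]

/-- The word length is given by the weight. -/
theorem len_monoMat {e n : ℕ} (he : 1 ≤ e) (hn : 2 ≤ n) (c : Equiv.Perm (Fin n))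
    {a : Fin n → ℂ} (ha : IsEntries e a) : len e n (monoMat c a) = weight c a := by
  refine IsLeast.csInf_eq ⟨exists_word he hn _ c a ha rfl, ?_⟩
  rintro l ⟨L, hL, hprod, rfl⟩
  obtain ⟨c', a', ha', hprod', hle⟩ := weight_le_length he hn L hL
  obtain ⟨rfl, rfl⟩ := monoMat_injective (ha'.ne_zero he) (hprod'.trans hprod)
  exact hle

theorem IsGeen.exists_monoMat {e n : ℕ} {w : Matrix (Fin n) (Fin n) ℂ} (hw : IsGeen e n w)
    {c : Fin n → Fin n} (hc : ∀ r, w r (c r) ≠ 0) :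
    ∃ σ : Equiv.Perm (Fin n), (∀ r, σ r = c r) ∧ IsEntries e (fun r => w r (c r)) ∧
      w = monoMat σ (fun r => w r (c r)) := by
  obtain ⟨hrow, hcol, hroot, hprod⟩ := hw
  have hinj : Function.Injective c := fun p q hpq =>
    (hcol (c p)).unique (hc p) (by rw [hpq]; exact hc q)
  have hzero : ∀ p q, q ≠ c p → w p q = 0 := fun p q hq =>
    by_contra fun h => hq ((hrow p).unique h (hc p))
  refine ⟨Equiv.ofBijective c (Finite.injective_iff_bijective.1 hinj), fun _ => rfl,
    ⟨fun p => hroot _ _ (hc p), ?_⟩, ?_⟩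
  · rw [← hprod]
    exact Finset.prod_congr rfl fun p _ =>
      (Fintype.sum_eq_single (c p) fun q hq => hzero p q hq).symm
  · ext p q
    simp only [monoMat, Matrix.of_apply, Equiv.ofBijective_apply]
    split_ifs with h
    · rw [h]
    · exact hzero p q h

/-- Effect of left multiplication by `s_i` on the length.
Rows are 1-based: rows `i-1` and `i` correspond to the indices `r1, r2 : Fin n`
with `r1 = i - 2`, `r2 = i - 1` (0-based); `c r` is the unique column of the
nonzero entry of row `r`, and `a_i = w r2 (c r2)`, `a_{i-1} = w r1 (c r1)`. -/
theorem statement2 (e n : ℕ) (he : 1 ≤ e) (hn : 2 ≤ n)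
    (w : Matrix (Fin n) (Fin n) ℂ) (hw : IsGeen e n w)
    (c : Fin n → Fin n) (hc : ∀ r, w r (c r) ≠ 0)
    (i : ℕ) (hi3 : 3 ≤ i) (hin : i ≤ n)
    (r1 r2 : Fin n) (hr1 : (r1 : ℕ) = i - 2) (hr2 : (r2 : ℕ) = i - 1) :
    (c r1 < c r2 →
      (len e n (smat n i * w) + 1 = len e n w ↔ w r2 (c r2) ≠ 1)) ∧
    (c r2 < c r1 →
      (len e n (smat n i * w) + 1 = len e n w ↔ w r1 (c r1) = 1)) := by
  obtain ⟨σ, hσ, ha, hwσ⟩ := hw.exists_monoMat hc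
  have hdata := isGenData_one e (r1 := r1) (r2 := r2) (by omega)
  have hlen : len e n w = weight σ fun r => w r (c r) :=
    (congrArg (len e n) hwσ).trans (len_monoMat he hn σ ha)
  have hmul : smat n i * w = monoMat (σ * Equiv.swap r1 r2) (fun p =>
      1 * (fun r => w r (c r)) (Equiv.swap r1 r2 p)) :=
    (congrArg (smat n i * ·) hwσ).trans
      (by simp only [smat_eq_monoMat (by omega) hr1 hr2, monoMat_mul])
  rw [hmul, len_monoMat he hn _ (isEntries_genData hdata ha), hlen, ← hσ r1, ← hσ r2]
  constructor
  · intro h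
    have := weight_genData_of_lt hdata σ (fun r => w r (c r)) h
    simp only [← hσ] at this ⊢
    split_ifs at this with h1
    · simp only [h1, ne_eq, not_true, iff_false]
      omega
    · simp only [h1, ne_eq, not_false_iff, iff_true]
      omega
  · intro h
    have := weight_genData_of_gt hdata σ (fun r => w r (c r)) h
    simp only [one_mul, ← hσ] at this ⊢
    split_ifs at this with h1
    · simp only [h1, iff_true]
      omega
    · simp only [h1, iff_false]
      omega
end
end

section
/- In the interval [1, λ^k] ⊆ G(e,e,n) with left-division order, any two distinct atoms x, y ∈ X = {t_0,...,t_{e−1}, s_3,...,s_n} have a least common multiple, given by: t_i ∨ t_j = t_k t_0 = t_i t_{i−k} for i ≠ j; t_i ∨ s_3 = t_i s_3 t_i = s_3 t_i s_3; t_i ∨ s_j = t_i s_j for j ≥ 4; s_i ∨ s_{i+1} = s_i s_{i+1} s_i; and s_i ∨ s_j = s_i s_j for |i−j| > 1. -/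
noncomputable section

open Matrix

/-- Membership in the interval `[1, λ^k] ⊆ G(e,e,n)`. -/
def InInterval (e n k : ℕ) (w : Matrix (Fin n) (Fin n) ℂ) : Prop :=
  IsGeen e n w ∧ LDiv e n w (lamMat e n ^ k)

/-- `m` is a least common multiple of `x` and `y` in `([1,λ^k], ⪯)`. -/
def IsLcmIn (e n k : ℕ) (x y m : Matrix (Fin n) (Fin n) ℂ) : Prop :=
  InInterval e n k m ∧ LDiv e n x m ∧ LDiv e n y m ∧
  ∀ z, InInterval e n k z → LDiv e n x z → LDiv e n y z → LDiv e n m z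

/-- A monomial matrix with entries in the `e`-th roots of unity, encoded by the column and the
exponent of the nonzero entry of each row. -/
@[ext]
structure Mono (e n : ℕ) where
  /-- the column of the nonzero entry of each row -/
  col : Equiv.Perm (Fin n)
  /-- the exponent of the nonzero entry of each row -/
  ex : Fin n → ZMod e

namespace Mono

variable {e n : ℕ}

/-- The exponents sum to zero, that is, the nonzero entries have product `1`. -/
def Balanced (w : Mono e n) : Prop := ∑ r, w.ex r = 0

/-- The identity matrix. -/
def id (e n : ℕ) : Mono e n := ⟨1, 0⟩

/-- Matrix product. -/
def comp (u w : Mono e n) : Mono e n := ⟨u.col.trans w.col, fun r => u.ex r + w.ex (u.col r)⟩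

/-- The generator swapping the coordinates `p` and `q` with multipliers of exponents `-c` and `c`. -/
def gen (p q : Fin n) (c : ZMod e) : Mono e n :=
  ⟨Equiv.swap p q, fun r => if r = p then -c else if r = q then c else 0⟩

/-- The data of a generator in the Corran–Picantin set: adjacent coordinates, twisted only
when they are the first two. -/
def IsAtom (p q : Fin n) (c : ZMod e) : Prop := (q : ℕ) = p + 1 ∧ ((p : ℕ) = 0 ∨ c = 0)

/-- The contribution of a pair of rows to the length. -/
def pairLen (w : Mono e n) (x y : Fin n) : ℕ :=
  if w.col y < w.col x then 1 else if w.ex y = 0 then 0 else 2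

/-- Closed formula for the length. -/
def length (w : Mono e n) : ℕ := ∑ z : Fin n × Fin n, if z.1 < z.2 then w.pairLen z.1 z.2 else 0

/-- The condition for left multiplication by `gen p q c` to decrease the length. -/
def Descent (w : Mono e n) (p q : Fin n) (c : ZMod e) : Prop :=
  (w.col p < w.col q ∧ w.ex q ≠ 0) ∨ (w.col q < w.col p ∧ w.ex p = -c)

lemma IsAtom.ne {p q : Fin n} {c : ZMod e} (h : IsAtom p q c) : p ≠ q := by
  rintro rfl
  have := h.1
  omega

section gen_comp

variable {p q r : Fin n} {c : ZMod e} {w : Mono e n}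

lemma gen_comp_col_left : ((gen p q c).comp w).col p = w.col q := by
  simp [comp, gen]

lemma gen_comp_col_right : ((gen p q c).comp w).col q = w.col p := by
  simp [comp, gen]

lemma gen_comp_col_of_ne (hp : r ≠ p) (hq : r ≠ q) : ((gen p q c).comp w).col r = w.col r := by
  simp [comp, gen, Equiv.swap_apply_of_ne_of_ne hp hq]

lemma gen_comp_ex_left : ((gen p q c).comp w).ex p = w.ex q - c := by
  simp [comp, gen, sub_eq_neg_add]

lemma gen_comp_ex_right (h : p ≠ q) : ((gen p q c).comp w).ex q = w.ex p + c := by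
  simp [comp, gen, h.symm, add_comm]

lemma gen_comp_ex_of_ne (hp : r ≠ p) (hq : r ≠ q) : ((gen p q c).comp w).ex r = w.ex r := by
  simp [comp, gen, Equiv.swap_apply_of_ne_of_ne hp hq, hp, hq]

end gen_comp

lemma id_comp (w : Mono e n) : (id e n).comp w = w := by
  ext <;> simp [id, comp]

lemma comp_id (w : Mono e n) : w.comp (id e n) = w := by
  ext <;> simp [id, comp]

lemma comp_assoc (u v w : Mono e n) : (u.comp v).comp w = u.comp (v.comp w) := by
  ext <;> simp [comp, add_assoc]

lemma gen_comp_gen_comp {p q : Fin n} (h : p ≠ q) (c : ZMod e) (w : Mono e n) :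
    (gen p q c).comp ((gen p q c).comp w) = w := by
  refine Mono.ext (Equiv.ext fun r => ?_) (funext fun r => ?_)
  all_goals
    rcases eq_or_ne r p with rfl | hp
    · simp [gen_comp_col_left, gen_comp_col_right, gen_comp_ex_left, gen_comp_ex_right h]
    rcases eq_or_ne r q with rfl | hq
    · simp [gen_comp_col_left, gen_comp_col_right, gen_comp_ex_left, gen_comp_ex_right h]
    simp [gen_comp_col_of_ne hp hq, gen_comp_ex_of_ne hp hq]

lemma balanced_id : (id e n).Balanced := by simp [Balanced, id]

lemma Balanced.comp {u w : Mono e n} (hu : u.Balanced) (hw : w.Balanced) :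
    (u.comp w).Balanced := by
  unfold Balanced at *
  simp only [Mono.comp, Finset.sum_add_distrib, hu, Equiv.sum_comp u.col w.ex, hw, add_zero]

lemma balanced_gen {p q : Fin n} (h : p ≠ q) (c : ZMod e) : (gen p q c).Balanced := by
  have : ∀ r, (gen p q c).ex r = (if r = p then -c else 0) + (if r = q then c else 0) := by
    intro r
    rcases eq_or_ne r p with rfl | hp
    · simp [gen, h]
    · simp [gen, hp]
  simp [Balanced, this, Finset.sum_add_distrib]

lemma length_id : (id e n).length = 0 := by
  refine Finset.sum_eq_zero fun z _ => ?_
  split_ifs with h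
  · simp [pairLen, id, h.le]
  · rfl

lemma length_gen_comp_add {p q : Fin n} {c : ZMod e} (h : IsAtom p q c) (w : Mono e n) :
    ((gen p q c).comp w).length + w.pairLen p q =
      w.length + ((gen p q c).comp w).pairLen p q := by
  have hpq := h.ne
  set w' := (gen p q c).comp w with hw'
  have key : ∀ z : Fin n × Fin n,
      (if Equiv.swap p q z.1 < Equiv.swap p q z.2
        then w'.pairLen (Equiv.swap p q z.1) (Equiv.swap p q z.2) else 0) +
      (if z = (p, q) then w.pairLen p q else 0) =
      (if z.1 < z.2 then w.pairLen z.1 z.2 else 0) +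
      (if z = (q, p) then w'.pairLen p q else 0) := by
    obtain ⟨h1, h2⟩ := h
    have hlt : p < q := by rw [Fin.lt_def]; omega
    rintro ⟨x, y⟩
    rcases eq_or_ne x p with rfl | hxp
    · rcases eq_or_ne y x with rfl | hyp
      · simp [hpq]
      rcases eq_or_ne y q with rfl | hyq
      · simp [hpq, hlt, hlt.not_gt]
      have e1 : q < y ↔ x < y := by
        rw [Fin.lt_def, Fin.lt_def]; have := Fin.val_ne_of_ne hyq; omega
      simp [hyp, hyq, hpq, Equiv.swap_apply_of_ne_of_ne hyp hyq, e1, pairLen, hw',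
        gen_comp_col_right, gen_comp_col_of_ne hyp hyq, gen_comp_ex_of_ne hyp hyq]
    rcases eq_or_ne x q with rfl | hxq
    · rcases eq_or_ne y x with rfl | hyq
      · simp [hpq.symm]
      rcases eq_or_ne y p with rfl | hyp
      · simp [hpq.symm, hlt, hlt.not_gt]
      have e1 : p < y ↔ x < y := by
        rw [Fin.lt_def, Fin.lt_def]; have := Fin.val_ne_of_ne hyq; omega
      simp [hyp, hyq, hpq.symm, Equiv.swap_apply_of_ne_of_ne hyp hyq, e1, pairLen, hw',
        gen_comp_col_left, gen_comp_col_of_ne hyp hyq, gen_comp_ex_of_ne hyp hyq]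
    rcases eq_or_ne y p with rfl | hyp
    · have e1 : x < q ↔ x < y := by
        rw [Fin.lt_def, Fin.lt_def]; have := Fin.val_ne_of_ne hxp; omega
      rcases h2 with h2 | rfl
      · have e2 : ¬ x < y := by rw [Fin.lt_def]; omega
        simp [hxp, hxq, Equiv.swap_apply_of_ne_of_ne hxp hxq, e1, e2]
      · simp [hxp, hxq, Equiv.swap_apply_of_ne_of_ne hxp hxq, e1, pairLen, hw',
          gen_comp_col_right, gen_comp_col_of_ne hxp hxq, gen_comp_ex_right hpq]
    rcases eq_or_ne y q with rfl | hyq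
    · have e1 : x < p ↔ x < y := by
        rw [Fin.lt_def, Fin.lt_def]; have := Fin.val_ne_of_ne hxp; omega
      rcases h2 with h2 | rfl
      · have e2 : ¬ x < y := by
          rw [Fin.lt_def]; have := Fin.val_ne_of_ne hxp; omega
        simp [hxp, hxq, Equiv.swap_apply_of_ne_of_ne hxp hxq, e1, e2]
      · simp [hxp, hxq, Equiv.swap_apply_of_ne_of_ne hxp hxq, e1, pairLen, hw',
          gen_comp_col_left, gen_comp_col_of_ne hxp hxq, gen_comp_ex_left]
    simp [hxp, hxq, hyp, hyq, Equiv.swap_apply_of_ne_of_ne hxp hxq,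
      Equiv.swap_apply_of_ne_of_ne hyp hyq, pairLen, hw', gen_comp_col_of_ne hxp hxq,
      gen_comp_col_of_ne hyp hyq, gen_comp_ex_of_ne hyp hyq]
  have hsum := Finset.sum_congr (rfl : (Finset.univ : Finset (Fin n × Fin n)) = _)
    fun z _ => key z
  rw [Finset.sum_add_distrib, Finset.sum_add_distrib, Finset.sum_ite_eq', Finset.sum_ite_eq',
    if_pos (Finset.mem_univ _), if_pos (Finset.mem_univ _)] at hsum
  have hre := Equiv.sum_comp ((Equiv.swap p q).prodCongr (Equiv.swap p q))
    fun z : Fin n × Fin n => if z.1 < z.2 then w'.pairLen z.1 z.2 else 0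
  simp only [Equiv.prodCongr_apply, Prod.map_fst, Prod.map_snd] at hre
  rw [hre] at hsum
  exact hsum

lemma length_of_descent {p q : Fin n} {c : ZMod e} (h : IsAtom p q c) {w : Mono e n}
    (hd : w.Descent p q c) : ((gen p q c).comp w).length + 1 = w.length := by
  have key := length_gen_comp_add h w
  simp only [pairLen, gen_comp_col_left, gen_comp_col_right, gen_comp_ex_right h.ne] at key
  rcases hd with ⟨h1, h2⟩ | ⟨h1, h2⟩
  · simp only [h1, h1.not_gt, h2, if_true, if_false] at key
    omega
  · simp only [h1, h1.not_gt, h2, neg_add_cancel, if_true, if_false] at key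
    omega

lemma length_of_not_descent {p q : Fin n} {c : ZMod e} (h : IsAtom p q c) {w : Mono e n}
    (hd : ¬ w.Descent p q c) : ((gen p q c).comp w).length = w.length + 1 := by
  have key := length_gen_comp_add h w
  simp only [pairLen, gen_comp_col_left, gen_comp_col_right, gen_comp_ex_right h.ne] at key
  have hne : w.col p ≠ w.col q := fun hh => h.ne (w.col.injective hh)
  simp only [Descent, not_or, not_and, not_not] at hd
  rcases hne.lt_or_gt with h1 | h1
  · simp only [h1, h1.not_gt, hd.1 h1, if_true, if_false] at key
    omega
  · have : w.ex p + c ≠ 0 := fun hh => hd.2 h1 (eq_neg_of_add_eq_zero_left hh)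
    simp only [h1, h1.not_gt, this, if_true, if_false] at key
    omega

lemma length_gen_comp_le {p q : Fin n} {c : ZMod e} (h : IsAtom p q c) (w : Mono e n) :
    ((gen p q c).comp w).length ≤ w.length + 1 := by
  by_cases hd : w.Descent p q c
  · have := length_of_descent h hd
    omega
  · exact (length_of_not_descent h hd).le

lemma exists_descent {w : Mono e n} (hw : w.Balanced) (hne : w ≠ id e n) :
    ∃ p q c, IsAtom p q c ∧ w.Descent p q c := by
  by_contra! hcon
  have step : ∀ m (hm : m + 1 < n), w.col ⟨m, by omega⟩ < w.col ⟨m + 1, hm⟩ ∧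
      w.ex ⟨m + 1, hm⟩ = 0 := by
    intro m
    induction m with
    | zero =>
      intro hm
      have h0 := hcon ⟨0, by omega⟩ ⟨0 + 1, hm⟩ (-w.ex ⟨0, by omega⟩) ⟨rfl, Or.inl rfl⟩
      have hcol : w.col ⟨0, by omega⟩ ≠ w.col ⟨0 + 1, hm⟩ := fun hh => by
        have := w.col.injective hh
        simp at this
      simp only [Descent, neg_neg, and_true, not_or, not_and, not_not] at h0
      have hlt := lt_of_le_of_ne (not_lt.1 h0.2) hcol
      exact ⟨hlt, h0.1 hlt⟩
    | succ m ih =>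
      intro hm
      have h0 := hcon ⟨m + 1, by omega⟩ ⟨m + 1 + 1, hm⟩ 0 ⟨rfl, Or.inr rfl⟩
      have hcol : w.col ⟨m + 1, by omega⟩ ≠ w.col ⟨m + 1 + 1, hm⟩ := fun hh => by
        have := w.col.injective hh
        simp at this
      simp only [Descent, (ih (by omega)).2, neg_zero, and_true, not_or, not_and, not_not] at h0
      have hlt := lt_of_le_of_ne (not_lt.1 h0.2) hcol
      exact ⟨hlt, h0.1 hlt⟩
  apply hne
  rcases n with _ | n
  · exact Mono.ext (Subsingleton.elim _ _) (Subsingleton.elim _ _)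
  have hmono : StrictMono w.col := Fin.strictMono_iff_lt_succ.2 fun i => (step i (by omega)).1
  have hex : ∀ i : Fin n, w.ex i.succ = 0 := fun i => (step i (by omega)).2
  have hcol : w.col = 1 := by
    refine Equiv.ext fun i => ?_
    have := congrArg (fun f : Fin (n + 1) ≃o Fin (n + 1) => f i)
      (Subsingleton.elim (hmono.orderIsoOfSurjective _ w.col.surjective) (OrderIso.refl _))
    simpa using this
  refine Mono.ext hcol (funext fun i => ?_)
  refine Fin.cases ?_ hex i
  have h0 : w.ex 0 = 0 := by simpa [Balanced, Fin.sum_univ_succ, hex] using hw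
  exact h0

end Mono

lemma stdAddChar_natCast (e : ℕ) [NeZero e] (i : ℕ) :
    ZMod.stdAddChar (i : ZMod e) = zeta e ^ i := by
  have := ZMod.stdAddChar_coe (N := e) i
  push_cast at this
  rw [this, zeta, ← Complex.exp_nat_mul]
  congr 1
  ring

lemma stdAddChar_neg_natCast (e : ℕ) [NeZero e] (i : ℕ) :
    ZMod.stdAddChar (-(i : ZMod e)) = (zeta e)⁻¹ ^ i := by
  rw [AddChar.map_neg_eq_inv, stdAddChar_natCast, inv_pow]

lemma stdAddChar_ne_zero {e : ℕ} [NeZero e] (c : ZMod e) : ZMod.stdAddChar c ≠ 0 :=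
  fun h => by
    have := AddChar.map_add_eq_mul ZMod.stdAddChar c (-c)
    simp [h] at this

lemma stdAddChar_sum {e : ℕ} [NeZero e] {ι : Type*} (s : Finset ι) (a : ι → ZMod e) :
    ZMod.stdAddChar (∑ i ∈ s, a i) = ∏ i ∈ s, ZMod.stdAddChar (a i) := by
  classical
  induction s using Finset.induction_on with
  | empty => simp
  | insert i s hi ih => rw [Finset.sum_insert hi, Finset.prod_insert hi, AddChar.map_add_eq_mul, ih]

lemma exists_stdAddChar_eq {e : ℕ} [NeZero e] {x : ℂ} (hx : x ^ e = 1) :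
    ∃ c : ZMod e, ZMod.stdAddChar c = x := by
  obtain ⟨i, -, hi⟩ :=
    (Complex.isPrimitiveRoot_exp e (NeZero.ne e)).eq_pow_of_pow_eq_one hx
  exact ⟨i, by rw [stdAddChar_natCast, ← hi, zeta]⟩

namespace Mono

variable {e n : ℕ} [NeZero e]

/-- The monomial matrix encoded by `w`. -/
def toMatrix (w : Mono e n) : Matrix (Fin n) (Fin n) ℂ :=
  Matrix.of fun r s => if w.col r = s then ZMod.stdAddChar (w.ex r) else 0

lemma toMatrix_apply (w : Mono e n) (r s : Fin n) :
    w.toMatrix r s = if w.col r = s then ZMod.stdAddChar (w.ex r) else 0 := rfl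

lemma toMatrix_ne_zero_iff {w : Mono e n} {r s : Fin n} : w.toMatrix r s ≠ 0 ↔ w.col r = s := by
  simp [toMatrix_apply, stdAddChar_ne_zero]

lemma toMatrix_injective : Function.Injective (toMatrix : Mono e n → _) := by
  intro u w h
  have hcol : ∀ r, u.col r = w.col r := fun r => by
    rw [eq_comm, ← toMatrix_ne_zero_iff, ← h, toMatrix_ne_zero_iff]
  refine Mono.ext (Equiv.ext hcol) (funext fun r => ZMod.injective_stdAddChar ?_)
  have := congrFun (congrFun h r) (w.col r)
  simpa [toMatrix_apply, hcol] using this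

lemma toMatrix_id : (id e n).toMatrix = 1 := by
  ext r s
  simp [toMatrix_apply, id, Matrix.one_apply]

lemma toMatrix_comp (u w : Mono e n) : (u.comp w).toMatrix = u.toMatrix * w.toMatrix := by
  ext r s
  rw [Matrix.mul_apply, Finset.sum_eq_single (u.col r)]
  · simp [toMatrix_apply, comp, AddChar.map_add_eq_mul]
  · intro j _ hj
    simp [toMatrix_apply u, hj.symm]
  · simp

lemma isGeen_toMatrix {w : Mono e n} (hw : w.Balanced) : IsGeen e n w.toMatrix := by
  refine ⟨fun i => ?_, fun j => ?_, fun i j hij => ?_, ?_⟩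
  · simp only [toMatrix_ne_zero_iff]
    exact ⟨_, rfl, fun _ h => h.symm⟩
  · simp only [toMatrix_ne_zero_iff]
    exact ⟨w.col.symm j, by simp, fun _ h => by simp [← h]⟩
  · rw [toMatrix_ne_zero_iff] at hij
    rw [toMatrix_apply, if_pos hij, ← AddChar.map_nsmul_eq_pow]
    simp
  · simp only [toMatrix_apply, Finset.sum_ite_eq, Finset.mem_univ, if_true]
    rw [← stdAddChar_sum, show ∑ i, w.ex i = 0 from hw, AddChar.map_zero_eq_one]

lemma exists_of_isGeen {z : Matrix (Fin n) (Fin n) ℂ} (hz : IsGeen e n z) :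
    ∃ w : Mono e n, w.Balanced ∧ w.toMatrix = z := by
  obtain ⟨hrow, hcol, hroot, hprod⟩ := hz
  choose f hf hf' using hrow
  have hinj : Function.Injective f := fun i j hij =>
    (hcol (f i)).unique (hf i) (by simpa [hij] using hf j)
  choose a ha using fun i => exists_stdAddChar_eq (hroot i (f i) (hf i))
  have hz : ∀ i j, z i j = if f i = j then ZMod.stdAddChar (a i) else 0 := by
    intro i j
    split_ifs with h
    · rw [ha, h]
    · by_contra hne
      exact h (hf' i j hne).symm
  refine ⟨⟨Equiv.ofBijective f (Finite.injective_iff_bijective.1 hinj), a⟩, ?_, ?_⟩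
  · simp only [hz, Finset.sum_ite_eq, Finset.mem_univ, if_true,
      ← stdAddChar_sum] at hprod
    exact ZMod.injective_stdAddChar (hprod.trans (AddChar.map_zero_eq_one _).symm)
  · ext i j
    simp [toMatrix_apply, hz]

lemma toMatrix_gen_zero_one (h : 2 ≤ n) (i : ℕ) :
    (gen ⟨0, by omega⟩ ⟨1, h⟩ (i : ZMod e)).toMatrix = tmat e n i := by
  ext ⟨r, hr⟩ ⟨s, hs⟩
  simp only [toMatrix_apply, gen, tmat, Matrix.of_apply, Equiv.swap_apply_def, Fin.mk.injEq]
  split_ifs <;> simp_all [stdAddChar_natCast, stdAddChar_neg_natCast] <;> omega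

lemma toMatrix_gen_zero {j : ℕ} (h3 : 3 ≤ j) (hj : j ≤ n) :
    (gen ⟨j - 2, by omega⟩ ⟨j - 1, by omega⟩ (0 : ZMod e)).toMatrix = smat n j := by
  ext ⟨r, hr⟩ ⟨s, hs⟩
  simp only [toMatrix_apply, gen, smat, Matrix.of_apply, Equiv.swap_apply_def, Fin.mk.injEq,
    neg_zero, ite_self, AddChar.map_zero_eq_one]
  grind

lemma toMatrix_gen_mem_genSet {p q : Fin n} {c : ZMod e} (h : IsAtom p q c) :
    (gen p q c).toMatrix ∈ genSet e n := by
  obtain ⟨p, hp⟩ := p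
  obtain ⟨q, hq⟩ := q
  obtain ⟨h1, h2⟩ := h
  simp only at h1 h2
  subst h1
  rcases Nat.eq_zero_or_pos p with rfl | hp0
  · refine Or.inl ⟨c.val, c.val_lt, ?_⟩
    rw [← toMatrix_gen_zero_one hq, ZMod.natCast_zmod_val]
  · obtain rfl : c = 0 := by simpa [hp0.ne'] using h2
    refine Or.inr ⟨p + 2, by omega, by omega, ?_⟩
    rw [← toMatrix_gen_zero (e := e) (by omega) (by omega)]
    rfl

lemma exists_of_mem_genSet (hn : 2 ≤ n) {x : Matrix (Fin n) (Fin n) ℂ} (hx : x ∈ genSet e n) :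
    ∃ p q, ∃ c : ZMod e, IsAtom p q c ∧ (gen p q c).toMatrix = x := by
  rcases hx with ⟨i, -, rfl⟩ | ⟨j, h3, hj, rfl⟩
  · exact ⟨_, _, _, ⟨rfl, Or.inl rfl⟩, toMatrix_gen_zero_one hn i⟩
  · exact ⟨_, _, _, ⟨by simp only; omega, Or.inr rfl⟩, toMatrix_gen_zero h3 hj⟩

lemma exists_list_length_eq {w : Mono e n} (hw : w.Balanced) :
    ∃ L : List (Matrix (Fin n) (Fin n) ℂ),
      (∀ x ∈ L, x ∈ genSet e n) ∧ L.prod = w.toMatrix ∧ L.length = w.length := by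
  by_cases hid : w = id e n
  · exact ⟨[], by simp, by simp [hid, toMatrix_id], by simp [hid, length_id]⟩
  obtain ⟨p, q, c, h, hd⟩ := exists_descent hw hid
  have hlen := length_of_descent h hd
  obtain ⟨L, hL, hprod, hl⟩ := exists_list_length_eq ((balanced_gen h.ne c).comp hw)
  refine ⟨(gen p q c).toMatrix :: L, ?_, ?_, by simp [hl, hlen]⟩
  · simpa [toMatrix_gen_mem_genSet h] using hL
  · rw [List.prod_cons, hprod, ← toMatrix_comp, gen_comp_gen_comp h.ne]
termination_by w.length

lemma exists_of_list (hn : 2 ≤ n) (L : List (Matrix (Fin n) (Fin n) ℂ))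
    (hL : ∀ x ∈ L, x ∈ genSet e n) :
    ∃ w : Mono e n, w.Balanced ∧ w.toMatrix = L.prod ∧ w.length ≤ L.length := by
  induction L with
  | nil => exact ⟨id e n, balanced_id, toMatrix_id, by simp [length_id]⟩
  | cons x L ih =>
    obtain ⟨w, hw, hprod, hlen⟩ := ih fun y hy => hL y (by simp [hy])
    obtain ⟨p, q, c, h, rfl⟩ := exists_of_mem_genSet hn (hL x (by simp))
    exact ⟨_, (balanced_gen h.ne c).comp hw, by rw [toMatrix_comp, hprod, List.prod_cons],
      (length_gen_comp_le h w).trans (by simpa using hlen)⟩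

lemma len_toMatrix (hn : 2 ≤ n) {w : Mono e n} (hw : w.Balanced) :
    len e n w.toMatrix = w.length := by
  refine le_antisymm (Nat.sInf_le (exists_list_length_eq hw))
    (le_csInf ⟨_, exists_list_length_eq hw⟩ ?_)
  rintro _ ⟨L, hL, hprod, rfl⟩
  obtain ⟨u, -, hu, hlen⟩ := exists_of_list hn L hL
  rwa [toMatrix_injective (hu.trans hprod)] at hlen

end Mono

namespace Mono

section descent

variable {e n : ℕ}

lemma not_descent_id {p q : Fin n} {c : ZMod e} (h : IsAtom p q c) :
    ¬ (id e n).Descent p q c := by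
  have hlt : p < q := by rw [Fin.lt_def]; have := h.1; omega
  simp [Descent, id, hlt.not_gt]

lemma length_gen {p q : Fin n} {c : ZMod e} (h : IsAtom p q c) : (gen p q c).length = 1 := by
  have := length_of_not_descent h (not_descent_id h)
  rwa [comp_id, length_id] at this

lemma length_comp_le {u : Mono e n} (hu : u.Balanced) (w : Mono e n) :
    (u.comp w).length ≤ u.length + w.length := by
  by_cases hid : u = id e n
  · simp [hid, id_comp]
  obtain ⟨p, q, c, h, hd⟩ := exists_descent hu hid
  have hlen := length_of_descent h hd
  have ih := length_comp_le ((balanced_gen h.ne c).comp hu) w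
  have hle := length_gen_comp_le h (((gen p q c).comp u).comp w)
  rw [← comp_assoc, gen_comp_gen_comp h.ne] at hle
  omega
termination_by u.length

lemma gen_comp_gen_comm {p q p' q' : Fin n} (c c' : ZMod e) (hpq : p ≠ q) (hpq' : p' ≠ q')
    (h1 : p ≠ p') (h2 : p ≠ q') (h3 : q ≠ p') (h4 : q ≠ q') (w : Mono e n) :
    (gen p q c).comp ((gen p' q' c').comp w) = (gen p' q' c').comp ((gen p q c).comp w) := by
  refine Mono.ext (Equiv.ext fun r => ?_) (funext fun r => ?_)
  all_goals
    by_cases r = p <;> by_cases r = q <;> by_cases r = p' <;> by_cases r = q' <;> subst_vars <;>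
    simp_all [gen_comp_col_left, gen_comp_col_right, gen_comp_col_of_ne, gen_comp_ex_left,
      gen_comp_ex_right, gen_comp_ex_of_ne, Ne.symm]

lemma gen_comp_gen_braid {p q r : Fin n} (c : ZMod e) (hpq : p ≠ q) (hqr : q ≠ r) (hpr : p ≠ r)
    (w : Mono e n) :
    (gen p q c).comp ((gen q r 0).comp ((gen p q c).comp w)) =
      (gen q r 0).comp ((gen p q c).comp ((gen q r 0).comp w)) := by
  refine Mono.ext (Equiv.ext fun x => ?_) (funext fun x => ?_)
  all_goals
    by_cases x = p <;> by_cases x = q <;> by_cases x = r <;> subst_vars <;>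
    simp_all [gen_comp_col_left, gen_comp_col_right, gen_comp_col_of_ne, gen_comp_ex_left,
      gen_comp_ex_right, gen_comp_ex_of_ne, Ne.symm]

lemma gen_comp_gen_eq {p q : Fin n} (hpq : p ≠ q) {a b c d : ZMod e} (h : a - b = c - d) :
    (gen p q a).comp (gen p q b) = (gen p q c).comp (gen p q d) := by
  rw [← comp_id (gen p q b), ← comp_id (gen p q d)]
  have h' : b - a = d - c := by rw [← neg_sub, h, neg_sub]
  refine Mono.ext (Equiv.ext fun r => ?_) (funext fun r => ?_)
  all_goals
    rcases eq_or_ne r p with rfl | hp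
    · simp [gen_comp_col_left, gen_comp_col_right, gen_comp_ex_left, gen_comp_ex_right hpq, id, h',
        sub_eq_neg_add]
    rcases eq_or_ne r q with rfl | hq
    · simp [gen_comp_col_left, gen_comp_col_right, gen_comp_ex_left, gen_comp_ex_right hpq, id,
        neg_add_eq_sub, h]
    simp [gen_comp_col_of_ne hp hq, gen_comp_ex_of_ne hp hq]

lemma length_of_descent_comm {p q p' q' : Fin n} {c c' : ZMod e} (h : IsAtom p q c)
    (h' : IsAtom p' q' c') (h1 : p ≠ p') (h2 : p ≠ q') (h3 : q ≠ p') (h4 : q ≠ q')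
    {w : Mono e n} (hd : w.Descent p q c) (hd' : w.Descent p' q' c') :
    ((gen p' q' c').comp ((gen p q c).comp w)).length + 2 = w.length := by
  have l1 := length_of_descent h hd
  have l2 := length_of_descent h' (w := (gen p q c).comp w) (by
    simpa [Descent, gen_comp_col_of_ne h1.symm h3.symm, gen_comp_col_of_ne h2.symm h4.symm,
      gen_comp_ex_of_ne h1.symm h3.symm, gen_comp_ex_of_ne h2.symm h4.symm] using hd')
  omega

lemma length_of_descent_braid {p q r : Fin n} {c : ZMod e} (h : IsAtom p q c)
    (h' : IsAtom q r (0 : ZMod e)) (hpr : p ≠ r) {w : Mono e n} (hd : w.Descent p q c)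
    (hd' : w.Descent q r 0) :
    ((gen p q c).comp ((gen q r 0).comp ((gen p q c).comp w))).length + 3 = w.length := by
  have hpq := h.ne
  have hqr := h'.ne
  have hcol : w.col p ≠ w.col r := fun hh => hpr (w.col.injective hh)
  have l1 := length_of_descent h hd
  have l2 := length_of_descent h' (w := (gen p q c).comp w) (by
    simp only [Descent, gen_comp_col_right, gen_comp_col_of_ne hpr.symm hqr.symm,
      gen_comp_ex_right hpq, gen_comp_ex_of_ne hpr.symm hqr.symm] at hd hd' ⊢
    grind)
  have l3 := length_of_descent h (w := (gen q r 0).comp ((gen p q c).comp w)) (by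
    simp only [Descent, gen_comp_col_left, gen_comp_col_of_ne hpq hpr,
      gen_comp_col_of_ne hpr.symm hqr.symm, gen_comp_ex_left, gen_comp_ex_of_ne hpq hpr,
      gen_comp_ex_of_ne hpr.symm hqr.symm] at hd hd' ⊢
    grind)
  omega

/-- The diagonal element `λ^k`. -/
def lamPow (e n k : ℕ) : Mono e n :=
  ⟨1, fun r => if (r : ℕ) = 0 then -((n - 1 : ℕ) * k : ZMod e) else k⟩

lemma balanced_lamPow (e n k : ℕ) : (lamPow e n k).Balanced := by
  rcases n with _ | n
  · simp [Balanced]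
  · simp [Balanced, lamPow, Fin.sum_univ_succ]

lemma descent_lamPow {k : ℕ} (hk : (k : ZMod e) ≠ 0) {p q : Fin n} {c : ZMod e}
    (h : IsAtom p q c) : (lamPow e n k).Descent p q c := by
  have h1 := h.1
  refine Or.inl ⟨?_, ?_⟩
  · simp only [lamPow, Equiv.Perm.coe_one, id_eq, Fin.lt_def]
    omega
  · simpa [lamPow, h1] using hk

lemma ex_eq_of_comp_eq_lamPow {k : ℕ} (hk : (k : ZMod e) ≠ 0) {p q : Fin n}
    (h : ∀ c : ZMod e, IsAtom p q c) {w v : Mono e n} (hw : w.Balanced)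
    (hwv : w.comp v = lamPow e n k) (hlen : w.length + v.length = (lamPow e n k).length)
    (hcol : w.col p < w.col q) (hex : w.ex q ≠ 0) : w.ex q = k := by
  have hpq := (h 0).ne
  set a := w.ex q with ha
  have l1 := length_of_descent (h a) (w := w) (Or.inl ⟨hcol, hex⟩)
  have l2 := length_of_descent (h 0) (w := (gen p q a).comp w) (Or.inr
    ⟨by rwa [gen_comp_col_left, gen_comp_col_right], by rw [gen_comp_ex_left]; simp [ha]⟩)
  have l3 := length_comp_le ((balanced_gen hpq 0).comp ((balanced_gen hpq a).comp hw)) v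
  rw [comp_assoc, comp_assoc, hwv] at l3
  have l4 := length_of_descent (h a) (descent_lamPow hk (h a))
  by_contra hne
  have l5 := length_of_not_descent (h 0) (w := (gen p q a).comp (lamPow e n k)) (by
    have h1 := (h 0).1
    have hlt : p < q := by rw [Fin.lt_def]; omega
    simp [Descent, gen_comp_col_left, gen_comp_col_right, gen_comp_ex_left, lamPow, hlt.le, hlt,
      h1, sub_eq_zero, Ne.symm hne])
  omega

end descent

variable {e n : ℕ} [NeZero e]

lemma toMatrix_lamPow (k : ℕ) : (lamPow e n k).toMatrix = lamMat e n ^ k := by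
  have hlam : lamMat e n = Matrix.diagonal fun p : Fin n =>
      if (p : ℕ) = 0 then (zeta e)⁻¹ ^ (n - 1) else zeta e := by
    ext p q
    simp [lamMat, Matrix.diagonal_apply]
  rw [hlam, Matrix.diagonal_pow]
  ext p q
  rcases eq_or_ne p q with rfl | hpq
  · rw [Matrix.diagonal_apply_eq, toMatrix_apply, if_pos (by simp [lamPow])]
    simp only [lamPow, Pi.pow_apply]
    split_ifs
    · rw [← Nat.cast_mul, stdAddChar_neg_natCast, pow_mul]
    · rw [stdAddChar_natCast]
  · rw [Matrix.diagonal_apply_ne _ hpq, toMatrix_apply, if_neg (by simpa [lamPow] using hpq)]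

lemma ldiv_toMatrix_iff (hn : 2 ≤ n) {u w : Mono e n} (hu : u.Balanced) (hw : w.Balanced) :
    LDiv e n u.toMatrix w.toMatrix ↔
      ∃ v : Mono e n, v.Balanced ∧ u.comp v = w ∧ u.length + v.length = w.length := by
  constructor
  · rintro ⟨z, hz, hmul, hlen⟩
    obtain ⟨v, hv, rfl⟩ := exists_of_isGeen hz
    rw [len_toMatrix hn hu, len_toMatrix hn hv, len_toMatrix hn hw] at hlen
    rw [← toMatrix_comp] at hmul
    exact ⟨v, hv, toMatrix_injective hmul, hlen⟩
  · rintro ⟨v, hv, rfl, hlen⟩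
    refine ⟨v.toMatrix, isGeen_toMatrix hv, (toMatrix_comp u v).symm, ?_⟩
    rwa [len_toMatrix hn hu, len_toMatrix hn hv, len_toMatrix hn hw]

lemma ldiv_gen_iff (hn : 2 ≤ n) {p q : Fin n} {c : ZMod e} (h : IsAtom p q c) {w : Mono e n}
    (hw : w.Balanced) : LDiv e n (gen p q c).toMatrix w.toMatrix ↔ w.Descent p q c := by
  rw [ldiv_toMatrix_iff hn (balanced_gen h.ne c) hw]
  constructor
  · rintro ⟨v, -, rfl, hlen⟩
    by_contra hd
    have := length_of_not_descent h hd
    rw [gen_comp_gen_comp h.ne] at this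
    omega
  · intro hd
    refine ⟨_, (balanced_gen h.ne c).comp hw, gen_comp_gen_comp h.ne c w, ?_⟩
    rw [length_gen h, add_comm, length_of_descent h hd]

/-- A criterion for an invertible element `m` to be the least common multiple of
two atoms. -/
lemma isLcmIn_of_length (hn : 2 ≤ n) {k : ℕ} (hk : (k : ZMod e) ≠ 0) {p q p' q' : Fin n}
    {c c' : ZMod e} (h : IsAtom p q c) (h' : IsAtom p' q' c') {m m' u v : Mono e n} {l : ℕ}
    (hm : m.Balanced) (hm' : m'.Balanced) (hmm' : m.comp m' = id e n)
    (hu : (gen p q c).comp u = m) (hul : u.length + 1 ≤ l)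
    (hv : (gen p' q' c').comp v = m) (hvl : v.length + 1 ≤ l)
    (hlen : ∀ w : Mono e n, w.Balanced →
      (∃ x : Mono e n, w.comp x = lamPow e n k ∧ w.length + x.length = (lamPow e n k).length) →
      w.Descent p q c → w.Descent p' q' c' → (m'.comp w).length + l = w.length) :
    IsLcmIn e n k (gen p q c).toMatrix (gen p' q' c').toMatrix m.toMatrix := by
  have hlam := balanced_lamPow e n k
  have hmul : ∀ w : Mono e n, m.comp (m'.comp w) = w := fun w => by
    rw [← comp_assoc, hmm', id_comp]
  have hl := hlen _ hlam ⟨id e n, comp_id _, by rw [length_id, add_zero]⟩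
    (descent_lamPow hk h) (descent_lamPow hk h')
  have hsub := length_comp_le hm (m'.comp (lamPow e n k))
  rw [hmul] at hsub
  have hle := length_gen_comp_le h u
  rw [hu] at hle
  have hml : m.length = l := by omega
  have hdiv : ∀ w : Mono e n, w.Balanced → (m'.comp w).length + l = w.length →
      LDiv e n m.toMatrix w.toMatrix := fun w hw hwl =>
    (ldiv_toMatrix_iff hn hm hw).2 ⟨_, hm'.comp hw, hmul w, by omega⟩
  refine ⟨⟨isGeen_toMatrix hm, ?_⟩, ?_, ?_, ?_⟩
  · rw [← toMatrix_lamPow]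
    exact hdiv _ hlam hl
  · rw [ldiv_gen_iff hn h hm]
    by_contra hd
    have := length_of_not_descent h hd
    rw [← hu, gen_comp_gen_comp h.ne, hu] at this
    omega
  · rw [ldiv_gen_iff hn h' hm]
    by_contra hd
    have := length_of_not_descent h' hd
    rw [← hv, gen_comp_gen_comp h'.ne, hv] at this
    omega
  · rintro z ⟨hz, hzl⟩ hx hy
    obtain ⟨w, hw, rfl⟩ := exists_of_isGeen hz
    rw [← toMatrix_lamPow, ldiv_toMatrix_iff hn hw hlam] at hzl
    obtain ⟨x, -, hx1, hx2⟩ := hzl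
    exact hdiv w hw (hlen w hw ⟨x, hx1, hx2⟩ ((ldiv_gen_iff hn h hw).1 hx)
      ((ldiv_gen_iff hn h' hw).1 hy))

lemma gen_mul_gen_comm {p q p' q' : Fin n} {c c' : ZMod e} (h : IsAtom p q c)
    (h' : IsAtom p' q' c') (h1 : p ≠ p') (h2 : p ≠ q') (h3 : q ≠ p') (h4 : q ≠ q') :
    (gen p q c).toMatrix * (gen p' q' c').toMatrix =
      (gen p' q' c').toMatrix * (gen p q c).toMatrix := by
  have := gen_comp_gen_comm c c' h.ne h'.ne h1 h2 h3 h4 (id e n)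
  rw [comp_id, comp_id] at this
  rw [← toMatrix_comp, this, toMatrix_comp]

lemma gen_mul_gen_braid {p q r : Fin n} {c : ZMod e} (h : IsAtom p q c)
    (h' : IsAtom q r (0 : ZMod e)) (hpr : p ≠ r) :
    (gen p q c).toMatrix * (gen q r (0 : ZMod e)).toMatrix * (gen p q c).toMatrix =
      (gen q r (0 : ZMod e)).toMatrix * (gen p q c).toMatrix *
        (gen q r (0 : ZMod e)).toMatrix := by
  have := gen_comp_gen_braid c h.ne h'.ne hpr (id e n)
  rw [comp_id, comp_id] at this
  rw [mul_assoc, mul_assoc]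
  simp only [← toMatrix_comp, this]

lemma isLcmIn_comm (hn : 2 ≤ n) {k : ℕ} (hk : (k : ZMod e) ≠ 0) {p q p' q' : Fin n}
    {c c' : ZMod e} (h : IsAtom p q c) (h' : IsAtom p' q' c') (h1 : p ≠ p') (h2 : p ≠ q')
    (h3 : q ≠ p') (h4 : q ≠ q') :
    IsLcmIn e n k (gen p q c).toMatrix (gen p' q' c').toMatrix
      ((gen p q c).toMatrix * (gen p' q' c').toMatrix) := by
  have hb := balanced_gen h.ne c
  have hb' := balanced_gen h'.ne c'
  have hcomm := gen_comp_gen_comm c c' h.ne h'.ne h1 h2 h3 h4 (id e n)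
  rw [comp_id, comp_id] at hcomm
  rw [← toMatrix_comp]
  refine isLcmIn_of_length hn hk h h' (m' := (gen p' q' c').comp (gen p q c)) (l := 2)
    (hb.comp hb') (hb'.comp hb) ?_ rfl (by rw [length_gen h']) hcomm.symm
    (by rw [length_gen h]) ?_
  · rw [comp_assoc, gen_comp_gen_comp h'.ne]
    simpa [comp_id] using gen_comp_gen_comp h.ne c (id e n)
  · intro w _ _ hd hd'
    rw [comp_assoc]
    exact length_of_descent_comm h h' h1 h2 h3 h4 hd hd'

lemma isLcmIn_braid (hn : 2 ≤ n) {k : ℕ} (hk : (k : ZMod e) ≠ 0) {p q r : Fin n} {c : ZMod e}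
    (h : IsAtom p q c) (h' : IsAtom q r (0 : ZMod e)) (hpr : p ≠ r) :
    IsLcmIn e n k (gen p q c).toMatrix (gen q r (0 : ZMod e)).toMatrix
      ((gen p q c).toMatrix * (gen q r (0 : ZMod e)).toMatrix * (gen p q c).toMatrix) := by
  have hb := balanced_gen h.ne c
  have hb' := balanced_gen h'.ne (0 : ZMod e)
  have hbraid := gen_comp_gen_braid c h.ne h'.ne hpr (id e n)
  rw [comp_id, comp_id] at hbraid
  have hl := length_gen_comp_le h (gen q r 0)
  have hl' := length_gen_comp_le h' (gen p q c)
  rw [length_gen h] at hl'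
  rw [length_gen h'] at hl
  rw [mul_assoc, ← toMatrix_comp, ← toMatrix_comp]
  refine isLcmIn_of_length hn hk h h' (m' := (gen p q c).comp ((gen q r 0).comp (gen p q c)))
    (l := 3) (hb.comp (hb'.comp hb)) (hb.comp (hb'.comp hb)) ?_ rfl (by omega) hbraid.symm
    (by omega) ?_
  · rw [comp_assoc, comp_assoc, gen_comp_gen_comp h.ne, gen_comp_gen_comp h'.ne]
    simpa [comp_id] using gen_comp_gen_comp h.ne c (id e n)
  · intro w _ _ hd hd'
    rw [comp_assoc, comp_assoc]
    exact length_of_descent_braid h h' hpr hd hd'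

lemma isLcmIn_first (hn : 2 ≤ n) {k : ℕ} (hk : (k : ZMod e) ≠ 0) {p q : Fin n}
    (h : ∀ c : ZMod e, IsAtom p q c) {a b : ZMod e} (hab : a ≠ b) :
    IsLcmIn e n k (gen p q a).toMatrix (gen p q b).toMatrix
      ((gen p q (k : ZMod e)).toMatrix * (gen p q (0 : ZMod e)).toMatrix) := by
  have hpq := (h 0).ne
  have hb := fun c : ZMod e => balanced_gen hpq c
  have heq : ∀ c : ZMod e, (gen p q c).comp (gen p q (c - k)) =
      (gen p q (k : ZMod e)).comp (gen p q 0) := fun c => gen_comp_gen_eq hpq (by simp)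
  rw [← toMatrix_comp]
  refine isLcmIn_of_length hn hk (h a) (h b)
    (m' := (gen p q (0 : ZMod e)).comp (gen p q (k : ZMod e))) (l := 2)
    ((hb _).comp (hb _)) ((hb _).comp (hb _)) ?_ (heq a) (by rw [length_gen (h _)]) (heq b)
    (by rw [length_gen (h _)]) ?_
  · rw [comp_assoc, gen_comp_gen_comp hpq]
    simpa [comp_id] using gen_comp_gen_comp hpq (k : ZMod e) (id e n)
  · rintro w hw ⟨x, hx, hxl⟩ hd hd'
    have hcol : w.col p < w.col q ∧ w.ex q ≠ 0 := by
      rcases hd with hd | hd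
      · exact hd
      rcases hd' with hd' | hd'
      · exact hd'
      exact absurd (neg_injective (hd.2.symm.trans hd'.2)) hab
    have hex := ex_eq_of_comp_eq_lamPow hk h hw hx hxl hcol.1 hcol.2
    have l1 := length_of_descent (h k) (w := w) (Or.inl hcol)
    have l2 := length_of_descent (h 0) (w := (gen p q (k : ZMod e)).comp w) (Or.inr
      ⟨by rw [gen_comp_col_left, gen_comp_col_right]; exact hcol.1,
        by rw [gen_comp_ex_left, hex]; simp⟩)
    rw [comp_assoc]
    omega

end Mono

/-- In the interval `[1, λ^k]` with left division, any two
distinct atoms of `X = {t_0,…,t_{e-1}, s_3,…,s_n}` admit a least common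
multiple, given by the stated formulas (indices of `t` taken mod `e`, so
`t_{i-k} = t_{i+e-k}`). -/
theorem statement11 (e n k : ℕ) (he : 1 < e) (hn : 2 ≤ n)
    (hk1 : 1 ≤ k) (hk : k ≤ e - 1) :
    (∀ i j, i < e → j < e → i ≠ j →
      IsLcmIn e n k (tmat e n i) (tmat e n j) (tmat e n k * tmat e n 0) ∧
      tmat e n k * tmat e n 0 = tmat e n i * tmat e n (i + e - k)) ∧
    (3 ≤ n → ∀ i, i < e →
      IsLcmIn e n k (tmat e n i) (smat n 3) (tmat e n i * smat n 3 * tmat e n i) ∧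
      tmat e n i * smat n 3 * tmat e n i = smat n 3 * tmat e n i * smat n 3) ∧
    (∀ i j, i < e → 4 ≤ j → j ≤ n →
      IsLcmIn e n k (tmat e n i) (smat n j) (tmat e n i * smat n j) ∧
      tmat e n i * smat n j = smat n j * tmat e n i) ∧
    (∀ i, 3 ≤ i → i + 1 ≤ n →
      IsLcmIn e n k (smat n i) (smat n (i + 1)) (smat n i * smat n (i + 1) * smat n i) ∧
      smat n i * smat n (i + 1) * smat n i = smat n (i + 1) * smat n i * smat n (i + 1)) ∧
    (∀ i j, 3 ≤ i → i ≤ n → 3 ≤ j → j ≤ n → (i + 1 < j ∨ j + 1 < i) →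
      IsLcmIn e n k (smat n i) (smat n j) (smat n i * smat n j) ∧
      smat n i * smat n j = smat n j * smat n i) := by
  have : NeZero e := ⟨by omega⟩
  have hk0 : (k : ZMod e) ≠ 0 := by
    rw [Ne, ZMod.natCast_eq_zero_iff]
    exact fun hdvd => absurd (Nat.le_of_dvd hk1 hdvd) (by omega)
  have ht := fun i => Mono.toMatrix_gen_zero_one (e := e) hn i
  have ht0 := ht 0
  rw [Nat.cast_zero] at ht0
  have hatom_t : ∀ c : ZMod e,
      Mono.IsAtom (⟨0, by omega⟩ : Fin n) (⟨1, hn⟩ : Fin n) c := fun c => ⟨rfl, Or.inl rfl⟩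
  have hs : ∀ {j} (h3 : 3 ≤ j) (hj : j ≤ n), _ := fun h3 hj =>
    Mono.toMatrix_gen_zero (e := e) h3 hj
  have hatom_s : ∀ {j} (h3 : 3 ≤ j) (hj : j ≤ n), Mono.IsAtom (⟨j - 2, by omega⟩ : Fin n)
      (⟨j - 1, by omega⟩ : Fin n) (0 : ZMod e) := fun h3 hj =>
    ⟨by simp only; omega, Or.inr rfl⟩
  refine ⟨fun i j hi hj hij => ⟨?_, ?_⟩, fun h3 i _ => ?_, fun i j _ h4 hj => ?_,
    fun i h3 hi => ?_, fun i j h3 hi h3' hj hij => ?_⟩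
  · have hne : (i : ZMod e) ≠ j := fun h => hij (by
      rwa [ZMod.natCast_eq_natCast_iff', Nat.mod_eq_of_lt hi, Nat.mod_eq_of_lt hj] at h)
    have := Mono.isLcmIn_first hn hk0 hatom_t hne
    rwa [ht, ht, ht, ht0] at this
  · rw [← ht, ← ht, ← ht, ← ht, ← Mono.toMatrix_comp, ← Mono.toMatrix_comp]
    refine congrArg _ (Mono.gen_comp_gen_eq (hatom_t 0).ne ?_)
    rw [Nat.cast_sub (by omega)]
    simp
  · rw [← ht, ← hs le_rfl h3]
    have hne : (⟨0, by omega⟩ : Fin n) ≠ ⟨3 - 1, by omega⟩ := by simp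
    exact ⟨Mono.isLcmIn_braid hn hk0 (hatom_t i) (hatom_s le_rfl h3) hne,
      Mono.gen_mul_gen_braid (hatom_t i) (hatom_s le_rfl h3) hne⟩
  · rw [← ht, ← hs (by omega) hj]
    constructor
    · refine Mono.isLcmIn_comm hn hk0 (hatom_t i) (hatom_s (by omega) hj) ?_ ?_ ?_ ?_ <;>
      rw [Ne, Fin.mk.injEq] <;> omega
    · refine Mono.gen_mul_gen_comm (hatom_t i) (hatom_s (by omega) hj) ?_ ?_ ?_ ?_ <;>
      rw [Ne, Fin.mk.injEq] <;> omega
  · have hmid : (⟨i + 1 - 2, by omega⟩ : Fin n) = ⟨i - 1, by omega⟩ := by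
      rw [Fin.mk.injEq]; omega
    have hne : (⟨i - 2, by omega⟩ : Fin n) ≠ ⟨i + 1 - 1, by omega⟩ := by
      rw [Ne, Fin.mk.injEq]; omega
    have hs' := hs (j := i + 1) (by omega) hi
    have hatom := hatom_s (j := i + 1) (by omega) hi
    rw [hmid] at hs' hatom
    rw [← hs', ← hs h3 (by omega)]
    exact ⟨Mono.isLcmIn_braid hn hk0 (hatom_s h3 (by omega)) hatom hne,
      Mono.gen_mul_gen_braid (hatom_s h3 (by omega)) hatom hne⟩
  · rw [← hs h3 hi, ← hs h3' hj]
    constructor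
    · refine Mono.isLcmIn_comm hn hk0 (hatom_s h3 hi) (hatom_s h3' hj) ?_ ?_ ?_ ?_ <;>
      rw [Ne, Fin.mk.injEq] <;> omega
    · refine Mono.gen_mul_gen_comm (hatom_s h3 hi) (hatom_s h3' hj) ?_ ?_ ?_ ?_ <;>
      rw [Ne, Fin.mk.injEq] <;> omega
end
end
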